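/- arXiv:2604.24632 — 2 statements merged into one kernel-verified Lean document; each statement's English description precedes it below -/
import Mathlib

section
/- There is no finite constant C such that W₁(μ * γ, γ) ≤ C · ‖Cov(μ)‖_F holds for every dimension d ≥ 1 and every centred Borel probability measure μ on ℝ^d with finite second moment. That is, for every C > 0 there exist a dimension d and a centred probability measure μ on ℝ^d with finite second moment such that W₁(μ * γ, γ) > C · ‖Cov(μ)‖_F. -/
open MeasureTheory ProbabilityTheory Real ENNReal RealInnerProductSpace

noncomputable section

/-- The set of couplings of two measures `μ` and `ν`. -/
def couplings {E : Type*} [MeasurableSpace E] (μ ν : Measure E) : Set (Measure (E × E)) :=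
  {τ | τ.map Prod.fst = μ ∧ τ.map Prod.snd = ν}

/-- The Wasserstein-`p` distance, valued in `ℝ≥0∞`:
`W_p(μ,ν) = (inf over couplings τ of ∫ ‖z₁ - z₂‖^p dτ)^{1/p}`. -/
noncomputable def Wp {E : Type*} [MeasurableSpace E] [NormedAddCommGroup E]
    (p : ℝ) (μ ν : Measure E) : ℝ≥0∞ :=
  (⨅ τ ∈ couplings μ ν, ∫⁻ z : E × E, ENNReal.ofReal (‖z.1 - z.2‖ ^ p) ∂τ) ^ (1 / p)

/-- The standard Gaussian measure `N(0, I_d)` on `ℝ^d`. -/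
noncomputable def stdGaussian (d : ℕ) : Measure (EuclideanSpace ℝ (Fin d)) :=
  (Measure.pi fun _ : Fin d => gaussianReal 0 1).map
    ((EuclideanSpace.equiv (Fin d) ℝ).symm : (Fin d → ℝ) → EuclideanSpace ℝ (Fin d))

/-- The Gaussian measure `N(m, I_d)` on `ℝ^d`. -/
noncomputable def gaussianE (d : ℕ) (m : EuclideanSpace ℝ (Fin d)) :
    Measure (EuclideanSpace ℝ (Fin d)) :=
  (stdGaussian d).map (fun x => m + x)

/-- `C_p = (E_{ξ ∼ N(0,1)} |ξ|^p)^{1/p}`. -/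
noncomputable def Cconst (p : ℝ) : ℝ := (∫ ξ : ℝ, |ξ| ^ p ∂(gaussianReal 0 1)) ^ (1 / p)

/-- `K_p = max {1, C_p/2 + 1/3}`. -/
noncomputable def Kconst (p : ℝ) : ℝ := max 1 (Cconst p / 2 + 1 / 3)

/-- The constant `c₄ = (e⁴ - 5)/16`. -/
noncomputable def cFour : ℝ := (Real.exp 4 - 5) / 16

/-- The (second-moment) covariance matrix `∫ x xᵀ dμ` of a (centred) measure on `ℝ^d`. -/
noncomputable def covMat {d : ℕ} (μ : Measure (EuclideanSpace ℝ (Fin d))) :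
    Matrix (Fin d) (Fin d) ℝ :=
  Matrix.of fun i j => ∫ x, x i * x j ∂μ

/-- The Frobenius norm of a matrix. -/
noncomputable def frob {d : ℕ} (A : Matrix (Fin d) (Fin d) ℝ) : ℝ :=
  Real.sqrt (∑ i, ∑ j, (A i j) ^ 2)

/-- `τ₁ = E[‖X‖ 1_{‖X‖ > 1}]`. -/
noncomputable def tailOne {d : ℕ} (μ : Measure (EuclideanSpace ℝ (Fin d))) : ℝ :=
  ∫ x in {x : EuclideanSpace ℝ (Fin d) | 1 < ‖x‖}, ‖x‖ ∂μ

/-- `τ₂ = (E[‖X‖² 1_{‖X‖ > 1}])^{1/2}`. -/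
noncomputable def tailTwo {d : ℕ} (μ : Measure (EuclideanSpace ℝ (Fin d))) : ℝ :=
  Real.sqrt (∫ x in {x : EuclideanSpace ℝ (Fin d) | 1 < ‖x‖}, ‖x‖ ^ 2 ∂μ)

/-- `m = E[X 1_{‖X‖ ≤ 1}]`. -/
noncomputable def truncMean {d : ℕ} (μ : Measure (EuclideanSpace ℝ (Fin d))) :
    EuclideanSpace ℝ (Fin d) :=
  ∫ x in {x : EuclideanSpace ℝ (Fin d) | ‖x‖ ≤ 1}, x ∂μ

/-- `X̃ = X 1_{‖X‖ ≤ 1} - E[X 1_{‖X‖ ≤ 1}]`, as a function of `X`. -/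
noncomputable def truncCentred {d : ℕ} (μ : Measure (EuclideanSpace ℝ (Fin d)))
    (x : EuclideanSpace ℝ (Fin d)) : EuclideanSpace ℝ (Fin d) :=
  (if ‖x‖ ≤ 1 then x else 0) - truncMean μ

/-- `Σ̃ = Cov(X̃) = E[X̃ X̃ᵀ]` (note `X̃` is centred). -/
noncomputable def truncCov {d : ℕ} (μ : Measure (EuclideanSpace ℝ (Fin d))) :
    Matrix (Fin d) (Fin d) ℝ :=
  Matrix.of fun i j => ∫ x, truncCentred μ x i * truncCentred μ x j ∂μ

/-- The chi-squared divergence `χ²(ρ ‖ γ) = ∫ ((dρ/dγ) - 1)² dγ`. -/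
noncomputable def chiSqDiv {E : Type*} [MeasurableSpace E] (ρ γm : Measure E) : ℝ :=
  ∫ x, ((ρ.rnDeriv γm x).toReal - 1) ^ 2 ∂γm

/-- The Kullback–Leibler divergence `KL(ρ ‖ γ) = ∫ log (dρ/dγ) dρ`. -/
noncomputable def klDivReal {E : Type*} [MeasurableSpace E] (ρ γm : Measure E) : ℝ :=
  ∫ x, Real.log ((ρ.rnDeriv γm x).toReal) ∂ρ

/-- The Jacobian matrix `∇φ(x)` of a map `φ : ℝ^d → ℝ^d`, with entry `(i,j)` equal to
`∂φ_i/∂x_j (x)`. -/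
noncomputable def jacobianM {d : ℕ}
    (φ : EuclideanSpace ℝ (Fin d) → EuclideanSpace ℝ (Fin d))
    (x : EuclideanSpace ℝ (Fin d)) : Matrix (Fin d) (Fin d) ℝ :=
  Matrix.of fun i j => fderiv ℝ φ x (EuclideanSpace.single j (1 : ℝ)) i

/-- `τ` is a Stein kernel for the centred measure `ρ` relative to the standard Gaussian:
for all `φ ∈ C_c^∞(ℝ^d; ℝ^d)`, `E⟨X, φ(X)⟩ = E[tr(τ(X) ∇φ(X))]`. -/
def IsSteinKernel {d : ℕ} (ρ : Measure (EuclideanSpace ℝ (Fin d)))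
    (τ : EuclideanSpace ℝ (Fin d) → Matrix (Fin d) (Fin d) ℝ) : Prop :=
  ∀ φ : EuclideanSpace ℝ (Fin d) → EuclideanSpace ℝ (Fin d),
    ContDiff ℝ (⊤ : ℕ∞) φ → HasCompactSupport φ →
      ∫ x, ⟪x, φ x⟫ ∂ρ = ∫ x, Matrix.trace (τ x * jacobianM φ x) ∂ρ

/-- The uniform probability measure on the `2d` points `± R eᵢ`, where `eᵢ` runs over the standard
basis of `ℝ^d`. -/
noncomputable def crossMeasure (d : ℕ) (R : ℝ) : Measure (EuclideanSpace ℝ (Fin d)) :=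
  ENNReal.ofReal (1 / (2 * d)) • ∑ i : Fin d,
    (Measure.dirac (EuclideanSpace.single i R) + Measure.dirac (EuclideanSpace.single i (-R)))

theorem isProbabilityMeasure_crossMeasure {d : ℕ} (hd : 0 < d) (R : ℝ) :
    IsProbabilityMeasure (crossMeasure d R) := by
  refine ⟨?_⟩
  have h : (0 : ℝ) < 2 * d := by positivity
  have h2 : (d : ℝ≥0∞) * (1 + 1) = ENNReal.ofReal (2 * d) := by
    rw [ENNReal.ofReal_mul (by norm_num), ENNReal.ofReal_natCast, one_add_one_eq_two, mul_comm]
    simp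
  simp only [crossMeasure, Measure.smul_apply, Measure.finsetSum_apply, Measure.add_apply,
    measure_univ, Finset.sum_const, Finset.card_univ, Fintype.card_fin, nsmul_eq_mul, smul_eq_mul]
  rw [h2, ← ENNReal.ofReal_mul (by positivity), one_div_mul_cancel h.ne', ENNReal.ofReal_one]

theorem integrable_crossMeasure {E : Type*} [NormedAddCommGroup E] {d : ℕ} {R : ℝ}
    (g : EuclideanSpace ℝ (Fin d) → E) : Integrable g (crossMeasure d R) := by
  refine Integrable.smul_measure ?_ ENNReal.ofReal_ne_top
  rw [integrable_finsetSum_measure]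
  exact fun i _ => (integrable_dirac enorm_lt_top).add_measure (integrable_dirac enorm_lt_top)

theorem integral_crossMeasure {E : Type*} [NormedAddCommGroup E] [NormedSpace ℝ E]
    [CompleteSpace E] {d : ℕ} {R : ℝ} (g : EuclideanSpace ℝ (Fin d) → E) :
    ∫ x, g x ∂(crossMeasure d R) = (1 / (2 * d) : ℝ) • ∑ i : Fin d,
      (g (EuclideanSpace.single i R) + g (EuclideanSpace.single i (-R))) := by
  have h : ∀ x : EuclideanSpace ℝ (Fin d), Integrable g (Measure.dirac x) :=
    fun x => integrable_dirac enorm_lt_top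
  rw [crossMeasure, integral_smul_measure, ENNReal.toReal_ofReal (by positivity),
    integral_finsetSum_measure fun i _ => (h _).add_measure (h _)]
  simp_rw [integral_add_measure (h _) (h _), integral_dirac]

theorem integral_id_crossMeasure {d : ℕ} {R : ℝ} : ∫ x, x ∂(crossMeasure d R) = 0 := by
  rw [integral_crossMeasure]
  refine smul_eq_zero_of_right _ (Finset.sum_eq_zero fun i _ => ?_)
  ext j
  by_cases h : j = i <;> simp [h]

theorem covMat_crossMeasure {d : ℕ} {R : ℝ} (i j : Fin d) :
    covMat (crossMeasure d R) i j = if i = j then R ^ 2 / d else 0 := by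
  simp only [covMat, Matrix.of_apply, integral_crossMeasure, smul_eq_mul]
  split_ifs with h
  · subst h
    rw [Finset.sum_eq_single i]
    · simp
      ring
    · intro b _ hb
      simp [hb.symm]
    · simp
  · rw [Finset.sum_eq_zero, mul_zero]
    intro k _
    by_cases hk : i = k
    · have : j ≠ k := fun hjk => h (hk.trans hjk.symm)
      simp [this]
    · simp [hk]

theorem frob_covMat_crossMeasure {n : ℕ} (hn : 0 < n) (R : ℝ) :
    frob (covMat (crossMeasure (n ^ 4) R)) = R ^ 2 / n ^ 2 := by
  have hn' : (n : ℝ) ≠ 0 := by positivity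
  simp only [frob, covMat_crossMeasure, ite_pow, ne_eq, OfNat.ofNat_ne_zero, not_false_eq_true,
    zero_pow, Finset.sum_ite_eq, Finset.mem_univ, if_true, Finset.sum_const, Finset.card_univ,
    Fintype.card_fin, nsmul_eq_mul]
  rw [← Real.sqrt_sq (by positivity : 0 ≤ R ^ 2 / (n : ℝ) ^ 2)]
  congr 1
  push_cast
  field_simp

instance isProbabilityMeasure_stdGaussian (d : ℕ) : IsProbabilityMeasure (stdGaussian d) :=
  Measure.isProbabilityMeasure_map
    (EuclideanSpace.equiv (Fin d) ℝ).symm.continuous.measurable.aemeasurable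

theorem lintegral_comp_apply_stdGaussian {d : ℕ} (i : Fin d) {g : ℝ → ℝ≥0∞} (hg : Measurable g) :
    ∫⁻ x, g (x i) ∂(stdGaussian d) = ∫⁻ t, g t ∂(gaussianReal 0 1) := by
  rw [_root_.stdGaussian, lintegral_map (by fun_prop)
    (EuclideanSpace.equiv (Fin d) ℝ).symm.continuous.measurable]
  exact (measurePreserving_eval (fun _ : Fin d => gaussianReal 0 1) i).lintegral_comp hg

/-- The sup norm of a vector is at most `s + (∑ xᵢ⁴) / s³`. -/
theorem norm_ofLp_le {d : ℕ} {s : ℝ} (hs : 0 < s) (x : EuclideanSpace ℝ (Fin d)) :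
    ‖x.ofLp‖ ≤ s + ∑ i, x i ^ 4 / s ^ 3 := by
  have hnn : ∀ i, 0 ≤ x i ^ 4 / s ^ 3 := fun i => by positivity
  rw [pi_norm_le_iff_of_nonneg (add_nonneg hs.le (Finset.sum_nonneg fun i _ => hnn i))]
  intro i
  refine le_trans ?_ (add_le_add_right
    (Finset.single_le_sum (fun j _ => hnn j) (Finset.mem_univ i)) s)
  rcases le_total ‖x i‖ s with h | h
  · linarith [hnn i]
  · have : ‖x i‖ ≤ x i ^ 4 / s ^ 3 := by
      rw [le_div_iff₀ (by positivity), ← Even.pow_abs (by decide : Even 4), ← Real.norm_eq_abs]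
      calc ‖x i‖ * s ^ 3 ≤ ‖x i‖ * ‖x i‖ ^ 3 := by gcongr
        _ = ‖x i‖ ^ 4 := by ring
    linarith

theorem lintegral_enorm_ofLp_stdGaussian_le {n : ℕ} (hn : 0 < n) :
    ∫⁻ x, ‖x.ofLp‖ₑ ∂(stdGaussian (n ^ 4)) ≤
      ENNReal.ofReal (n * (1 + ∫ t, t ^ 4 ∂(gaussianReal 0 1))) := by
  have hn' : (0 : ℝ) < n := by positivity
  have h_int : Integrable (fun t : ℝ => t ^ 4 / (n : ℝ) ^ 3) (gaussianReal 0 1) := by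
    refine Integrable.div_const ?_ _
    have := (memLp_id_gaussianReal (μ := 0) (v := 1) 4).integrable_norm_pow (p := 4) (by norm_num)
    refine this.congr (.of_forall fun t => ?_)
    simp [Even.pow_abs (by decide : Even 4)]
  have hK : 0 ≤ ∫ t : ℝ, t ^ 4 ∂(gaussianReal 0 1) := integral_nonneg fun t => by positivity
  calc ∫⁻ x, ‖x.ofLp‖ₑ ∂(stdGaussian (n ^ 4))
      ≤ ∫⁻ x, (ENNReal.ofReal n + ∑ i, ENNReal.ofReal (x i ^ 4 / (n : ℝ) ^ 3))
          ∂(stdGaussian (n ^ 4)) := by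
        refine lintegral_mono fun x => ?_
        rw [← ofReal_norm, ← ENNReal.ofReal_sum_of_nonneg fun i _ => by positivity,
          ← ENNReal.ofReal_add hn'.le (Finset.sum_nonneg fun i _ => by positivity)]
        exact ENNReal.ofReal_le_ofReal (norm_ofLp_le hn' x)
    _ = ENNReal.ofReal n + (n ^ 4 : ℕ) *
          ENNReal.ofReal (∫ t, t ^ 4 / (n : ℝ) ^ 3 ∂(gaussianReal 0 1)) := by
        rw [lintegral_add_left measurable_const, lintegral_const, measure_univ, mul_one,
          lintegral_finsetSum _ fun i _ => by fun_prop]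
        simp_rw [lintegral_comp_apply_stdGaussian (g := fun t => ENNReal.ofReal (t ^ 4 / (n : ℝ) ^ 3))
          _ (by fun_prop)]
        rw [ofReal_integral_eq_lintegral_ofReal h_int (.of_forall fun t => by positivity)]
        simp
    _ = ENNReal.ofReal (n * (1 + ∫ t, t ^ 4 ∂(gaussianReal 0 1))) := by
        rw [integral_div, ← ENNReal.ofReal_natCast, ← ENNReal.ofReal_mul (by positivity),
          ← ENNReal.ofReal_add (by positivity) (by positivity)]
        congr 1
        push_cast
        field_simp

theorem enorm_ofLp_le {d : ℕ} (x : EuclideanSpace ℝ (Fin d)) : ‖x.ofLp‖ₑ ≤ ‖x‖ₑ := by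
  rw [← ofReal_norm, ← ofReal_norm]
  exact ENNReal.ofReal_le_ofReal
    ((pi_norm_le_iff_of_nonneg (norm_nonneg x)).2 fun i => PiLp.norm_apply_le x i)

theorem measurable_enorm_ofLp {d : ℕ} :
    Measurable fun x : EuclideanSpace ℝ (Fin d) => ‖x.ofLp‖ₑ :=
  (PiLp.continuous_ofLp 2 _).measurable.enorm

/-- The sup norm is `1`-Lipschitz, hence its means differ by at most the `W₁` distance. -/
theorem lintegral_enorm_ofLp_le_add_Wp {d : ℕ} (μ ν : Measure (EuclideanSpace ℝ (Fin d))) :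
    ∫⁻ x, ‖x.ofLp‖ₑ ∂μ ≤ ∫⁻ x, ‖x.ofLp‖ₑ ∂ν + Wp 1 μ ν := by
  simp only [Wp, Real.rpow_one, div_one, ENNReal.rpow_one]
  simp_rw [ENNReal.add_iInf]
  refine le_iInf₂ fun τ hτ => ?_
  rw [← hτ.1, ← hτ.2, lintegral_map measurable_enorm_ofLp measurable_fst,
    lintegral_map measurable_enorm_ofLp measurable_snd,
    ← lintegral_add_left (by exact measurable_enorm_ofLp.comp measurable_snd)]
  refine lintegral_mono fun z => ?_
  simp only
  rw [ofReal_norm]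
  calc ‖z.1.ofLp‖ₑ = ‖z.2.ofLp + (z.1 - z.2).ofLp‖ₑ := by simp
    _ ≤ ‖z.2.ofLp‖ₑ + ‖(z.1 - z.2).ofLp‖ₑ := enorm_add_le _ _
    _ ≤ _ := by gcongr; exact enorm_ofLp_le _

theorem lintegral_enorm_ofLp_le_conv_add {d : ℕ} (μ ν : Measure (EuclideanSpace ℝ (Fin d)))
    [IsProbabilityMeasure μ] [IsProbabilityMeasure ν] :
    ∫⁻ x, ‖x.ofLp‖ₑ ∂μ ≤ ∫⁻ x, ‖x.ofLp‖ₑ ∂(μ ∗ ν) + ∫⁻ x, ‖x.ofLp‖ₑ ∂ν := by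
  rw [Measure.lintegral_conv measurable_enorm_ofLp]
  calc ∫⁻ x, ‖x.ofLp‖ₑ ∂μ
      ≤ ∫⁻ x, (∫⁻ y, ‖(x + y).ofLp‖ₑ ∂ν + ∫⁻ y, ‖y.ofLp‖ₑ ∂ν) ∂μ := by
        refine lintegral_mono fun x => ?_
        calc ‖x.ofLp‖ₑ = ∫⁻ _, ‖x.ofLp‖ₑ ∂ν := by simp
          _ ≤ ∫⁻ y, (‖(x + y).ofLp‖ₑ + ‖y.ofLp‖ₑ) ∂ν := by
            refine lintegral_mono fun y => ?_
            simpa using enorm_sub_le (a := (x + y).ofLp) (b := y.ofLp)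
          _ = _ := lintegral_add_right _ measurable_enorm_ofLp
    _ = _ := by rw [lintegral_add_right _ measurable_const]; simp

theorem lintegral_enorm_ofLp_crossMeasure {d : ℕ} (hd : 0 < d) {R : ℝ} (hR : 0 ≤ R) :
    ∫⁻ x, ‖x.ofLp‖ₑ ∂(crossMeasure d R) = ENNReal.ofReal R := by
  have hn : ∀ (i : Fin d) (r : ℝ), ‖(EuclideanSpace.single i r).ofLp‖ = |r| := fun i r => by
    simp [Pi.norm_single]
  have hd' : (0 : ℝ) < d := by positivity
  rw [← ofReal_integral_norm_eq_lintegral_enorm (integrable_crossMeasure _), integral_crossMeasure]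
  simp only [hn, abs_neg, abs_of_nonneg hR, Finset.sum_const, Finset.card_univ, Fintype.card_fin,
    nsmul_eq_mul, smul_eq_mul]
  congr 1
  field_simp
  ring

/-- no uniform covariance-Frobenius bound for `W₁(μ * γ, γ)`. -/
theorem no_uniform_frobenius_bound :
    ∀ C : ℝ, 0 < C →
      ∃ (d : ℕ) (μ : Measure (EuclideanSpace ℝ (Fin d))),
        IsProbabilityMeasure μ ∧ (∫ x, x ∂μ = 0) ∧
          Integrable (fun x => ‖x‖ ^ 2) μ ∧
          ENNReal.ofReal (C * frob (covMat μ)) <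
            Wp 1 (μ ∗ stdGaussian d) (stdGaussian d) := by
  intro C hC
  set K : ℝ := ∫ t, t ^ 4 ∂(gaussianReal 0 1) with hKdef
  have hK : 0 ≤ K := integral_nonneg fun t => by positivity
  obtain ⟨n, hn⟩ := exists_nat_gt (9 * C * (1 + K))
  have hn' : (0 : ℝ) < n := lt_of_le_of_lt (by positivity) hn
  have hn0 : 0 < n := by exact_mod_cast hn'
  have hd : 0 < n ^ 4 := by positivity
  have hprob := isProbabilityMeasure_crossMeasure hd (3 * (n * (1 + K)))
  refine ⟨n ^ 4, crossMeasure (n ^ 4) (3 * (n * (1 + K))), hprob,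
    integral_id_crossMeasure, integrable_crossMeasure _, ?_⟩
  rw [frob_covMat_crossMeasure hn0]
  have hM : 0 < n * (1 + K) := by positivity
  have hγ := lintegral_enorm_ofLp_stdGaussian_le hn0
  rw [← hKdef] at hγ
  have h1 := lintegral_enorm_ofLp_le_conv_add (crossMeasure (n ^ 4) (3 * (n * (1 + K))))
    (stdGaussian (n ^ 4))
  have h2 := lintegral_enorm_ofLp_le_add_Wp
    (crossMeasure (n ^ 4) (3 * (n * (1 + K))) ∗ stdGaussian (n ^ 4)) (stdGaussian (n ^ 4))
  rw [lintegral_enorm_ofLp_crossMeasure hd (by positivity)] at h1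
  set W := Wp 1 (crossMeasure (n ^ 4) (3 * (n * (1 + K))) ∗ stdGaussian (n ^ 4))
    (stdGaussian (n ^ 4))
  have h3 : ENNReal.ofReal (3 * (n * (1 + K))) ≤
      ENNReal.ofReal (2 * (n * (1 + K))) + W := by
    calc _ ≤ _ := h1.trans (add_le_add_left h2 _)
      _ ≤ (ENNReal.ofReal (n * (1 + K)) + W) + ENNReal.ofReal (n * (1 + K)) := by gcongr
      _ = _ := by rw [two_mul, ENNReal.ofReal_add hM.le hM.le]; ring
  have h4 : ENNReal.ofReal (n * (1 + K)) ≤ W := by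
    have := tsub_le_iff_left.2 h3
    rw [← ENNReal.ofReal_sub _ (by positivity)] at this
    rwa [show 3 * (n * (1 + K)) - 2 * (n * (1 + K)) = n * (1 + K) by ring] at this
  refine lt_of_lt_of_le ((ENNReal.ofReal_lt_ofReal_iff hM).2 ?_) h4
  have : C * ((3 * (n * (1 + K))) ^ 2 / (n : ℝ) ^ 2) = 9 * C * (1 + K) * (1 + K) := by
    field_simp
    ring
  rw [this]
  gcongr

end
end

section
/- Let a, b ∈ ℝ^d and p ≥ 1. Define ν = (1/2)N(a, I_d) + (1/2)N(b, I_d) and ν̃ = N((a+b)/2, I_d). Then W_p(ν, ν̃) ≤ (K_p/4) · ‖a − b‖², where K_p = max{1, C_p/2 + 1/3} and C_p = (E_{ξ∼N(0,1)} |ξ|^p)^{1/p}. -/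
open MeasureTheory ProbabilityTheory Real ENNReal RealInnerProductSpace

noncomputable section

/-- The cumulative distribution function of `N(0,1)`. -/
def gaussCdf (x : ℝ) : ℝ := cdf (gaussianReal 0 1) x

/-- The cumulative distribution function of `(1/2) N(h,1) + (1/2) N(-h,1)`. -/
def mixCdf (h x : ℝ) : ℝ := (gaussCdf (x - h) + gaussCdf (x + h)) / 2

theorem gaussCdf_eq_integral (x : ℝ) :
    gaussCdf x = ∫ t in Set.Iic x, gaussianPDFReal 0 1 t := by
  rw [gaussCdf, cdf_eq_real, measureReal_def, gaussianReal_apply_eq_integral _ one_ne_zero,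
    ENNReal.toReal_ofReal]
  exact setIntegral_nonneg measurableSet_Iic fun t _ => gaussianPDFReal_nonneg 0 1 t

theorem hasDerivAt_gaussCdf (x : ℝ) : HasDerivAt gaussCdf (gaussianPDFReal 0 1 x) x := by
  have hint := integrable_gaussianPDFReal 0 1
  have hcont : Continuous (gaussianPDFReal 0 1) := by
    unfold gaussianPDFReal; fun_prop
  have h : gaussCdf = fun y => gaussCdf 0 + ∫ t in (0 : ℝ)..y, gaussianPDFReal 0 1 t := by
    ext y
    rw [gaussCdf_eq_integral, gaussCdf_eq_integral,
      ← intervalIntegral.integral_Iic_sub_Iic hint.integrableOn hint.integrableOn]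
    ring
  rw [h]
  exact (intervalIntegral.integral_hasDerivAt_right hint.intervalIntegrable
    (hcont.stronglyMeasurableAtFilter _ _)
    hcont.continuousAt).const_add _

theorem strictMono_gaussCdf : StrictMono gaussCdf :=
  strictMono_of_deriv_pos fun x => by
    rw [(hasDerivAt_gaussCdf x).deriv]
    exact gaussianPDFReal_pos 0 1 x one_ne_zero

theorem continuous_gaussCdf : Continuous gaussCdf :=
  continuous_iff_continuousAt.2 fun x => (hasDerivAt_gaussCdf x).continuousAt

theorem gaussCdf_neg (x : ℝ) : gaussCdf (-x) = 1 - gaussCdf x := by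
  have hna : NullSingletonClass (gaussianReal 0 1) := nullSingletonClass_gaussianReal one_ne_zero
  have hmap : (gaussianReal 0 1).map (fun x => -x) = gaussianReal 0 1 := by
    simpa using gaussianReal_map_neg (μ := 0) (v := 1)
  rw [gaussCdf, gaussCdf, cdf_eq_real, cdf_eq_real, ← probReal_compl_eq_one_sub measurableSet_Iic]
  conv_lhs => rw [← hmap]
  rw [map_measureReal_apply measurable_neg measurableSet_Iic]
  refine measureReal_congr ?_
  have : (fun x : ℝ => -x) ⁻¹' Set.Iic (-x) = Set.Ici x := by ext; simp
  rw [this, Set.compl_Iic]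
  exact Ioi_ae_eq_Ici.symm

theorem strictMono_mixCdf (h : ℝ) : StrictMono (mixCdf h) := fun x y hxy => by
  have h₁ := strictMono_gaussCdf (sub_lt_sub_right hxy h)
  have h₂ := strictMono_gaussCdf (add_lt_add_left hxy h)
  simp only [mixCdf]
  linarith

theorem continuous_mixCdf (h : ℝ) : Continuous (mixCdf h) := by
  have := continuous_gaussCdf
  unfold mixCdf
  fun_prop

theorem mixCdf_neg (h x : ℝ) : mixCdf h (-x) = 1 - mixCdf h x := by
  have h₁ : -x - h = -(x + h) := by ring
  have h₂ : -x + h = -(x - h) := by ring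
  rw [mixCdf, mixCdf, h₁, h₂, gaussCdf_neg, gaussCdf_neg]
  ring

theorem exp_two_mul_one_sub_le {c : ℝ} (hc : 0 ≤ c) (hc1 : c < 1) :
    exp (2 * c) * (1 - c) ≤ 1 + c := by
  have h1 : 0 < 1 - c := by linarith
  have h := Real.le_log_one_add_of_nonneg (x := 2 * c / (1 - c)) (by positivity)
  have e1 : 2 * (2 * c / (1 - c)) / (2 * c / (1 - c) + 2) = 2 * c := by
    field_simp
    ring
  have e2 : 1 + 2 * c / (1 - c) = (1 + c) / (1 - c) := by
    field_simp
    ring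
  rw [e1, e2, Real.le_log_iff_exp_le (by positivity), le_div_iff₀ h1] at h
  exact h

theorem gaussianPDFReal_sub_eq (y s : ℝ) :
    gaussianPDFReal 0 1 (y - s) = exp (2 * (y * s)) * gaussianPDFReal 0 1 (y + s) := by
  simp only [gaussianPDFReal]
  rw [mul_left_comm, ← Real.exp_add]
  congr 2
  push_cast
  ring

theorem hasDerivAt_mixCdf_comp {y : ℝ → ℝ} {c s : ℝ} (hy : HasDerivAt y c s) :
    HasDerivAt (fun s => mixCdf s (y s))
      ((exp (2 * (y s * s)) * (c - 1) + (c + 1)) / 2 * gaussianPDFReal 0 1 (y s + s)) s := by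
  have h₁ := HasDerivAt.comp (h := fun s => y s - s) s (hasDerivAt_gaussCdf _) (hy.sub (hasDerivAt_id s))
  have h₂ := HasDerivAt.comp (h := fun s => y s + s) s (hasDerivAt_gaussCdf _) (hy.add (hasDerivAt_id s))
  have h := (h₁.add h₂).div_const 2
  rw [gaussianPDFReal_sub_eq] at h
  refine h.congr_deriv ?_
  ring

theorem mixCdf_zero (x : ℝ) : mixCdf 0 x = gaussCdf x := by
  simp [mixCdf]

theorem mixCdf_le_gaussCdf {h x : ℝ} (hh : 0 ≤ h) (hx : 0 ≤ x) : mixCdf h x ≤ gaussCdf x := by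
  have hd (s : ℝ) := hasDerivAt_mixCdf_comp (hasDerivAt_const s x)
  have := antitoneOn_of_deriv_nonpos (convex_Ici (0 : ℝ)) (f := fun s => mixCdf s x)
    (fun s _ => (hd s).continuousAt.continuousWithinAt)
    (fun s _ => (hd s).differentiableAt.differentiableWithinAt) (fun s hs => by
      rw [(hd s).deriv]
      rw [interior_Ici, Set.mem_Ioi] at hs
      have h1 : 1 ≤ exp (2 * (x * s)) := Real.one_le_exp (by positivity)
      exact mul_nonpos_of_nonpos_of_nonneg (by linarith) (gaussianPDFReal_nonneg _ _ _))
    Set.self_mem_Ici (Set.mem_Ici.2 hh) hh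
  simpa [mixCdf_zero] using this

theorem gaussCdf_le_mixCdf {h x : ℝ} (hh : 0 ≤ h) (hx : 0 ≤ x) :
    gaussCdf x ≤ mixCdf h (x + h ^ 2 * x / 2 + h ^ 3 / 3) := by
  have hy (s : ℝ) : HasDerivAt (fun s : ℝ => x + s ^ 2 * x / 2 + s ^ 3 / 3) (s * x + s ^ 2) s := by
    have h1 := (((hasDerivAt_pow 2 s).mul_const x).div_const 2).const_add x
    refine (h1.add ((hasDerivAt_pow 3 s).div_const 3)).congr_deriv ?_
    norm_num
    ring
  have hd (s : ℝ) := hasDerivAt_mixCdf_comp (hy s)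
  have := monotoneOn_of_deriv_nonneg (convex_Ici (0 : ℝ))
    (f := fun s => mixCdf s (x + s ^ 2 * x / 2 + s ^ 3 / 3))
    (fun s _ => (hd s).continuousAt.continuousWithinAt)
    (fun s _ => (hd s).differentiableAt.differentiableWithinAt) (fun s hs => by
      rw [(hd s).deriv]
      rw [interior_Ici, Set.mem_Ioi] at hs
      refine mul_nonneg (div_nonneg ?_ zero_le_two) (gaussianPDFReal_nonneg _ _ _)
      have hsx : 0 ≤ s * x := by positivity
      rcases le_or_gt 1 (s * x + s ^ 2) with hc | hc
      · have := mul_nonneg (Real.exp_pos (2 * ((x + s ^ 2 * x / 2 + s ^ 3 / 3) * s))).le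
          (sub_nonneg.2 hc)
        nlinarith [sq_nonneg s]
      · have h1 := exp_two_mul_one_sub_le (c := s * x + s ^ 2) (by positivity) hc
        have h2 : (x + s ^ 2 * x / 2 + s ^ 3 / 3) * s ≤ s * x + s ^ 2 := by
          nlinarith [mul_nonneg (sq_nonneg s)
            (by nlinarith [sq_nonneg s] : 0 ≤ 1 - s * x / 2 - s ^ 2 / 3)]
        have h3 := mul_le_mul_of_nonneg_right
          (Real.exp_le_exp.2 (mul_le_mul_of_nonneg_left h2 zero_le_two)) (sub_nonneg.2 hc.le)
        linarith)
    Set.self_mem_Ici (Set.mem_Ici.2 hh) hh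
  simpa [mixCdf_zero] using this

theorem exists_mixCdf_eq {h : ℝ} (hh : 0 ≤ h) (x : ℝ) : ∃ t, mixCdf h t = gaussCdf x := by
  have h1 : mixCdf h (x - h) ≤ gaussCdf x := by
    have := strictMono_gaussCdf.monotone (show x - h - h ≤ x by linarith)
    simp only [mixCdf, sub_add_cancel]
    linarith
  have h2 : gaussCdf x ≤ mixCdf h (x + h) := by
    have := strictMono_gaussCdf.monotone (show x ≤ x + h + h by linarith)
    simp only [mixCdf, add_sub_cancel_right]
    linarith
  obtain ⟨t, -, ht⟩ := intermediate_value_Icc (show x - h ≤ x + h by linarith)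
    (continuous_mixCdf h).continuousOn ⟨h1, h2⟩
  exact ⟨t, ht⟩

theorem exists_gaussCdf_eq {h : ℝ} (hh : 0 ≤ h) (t : ℝ) : ∃ x, gaussCdf x = mixCdf h t := by
  have h0 := strictMono_gaussCdf.monotone (show t - h ≤ t + h by linarith)
  obtain ⟨x, -, hx⟩ := intermediate_value_Icc (show t - h ≤ t + h by linarith)
    continuous_gaussCdf.continuousOn (show mixCdf h t ∈ _ from
      ⟨by simp only [mixCdf]; linarith, by simp only [mixCdf]; linarith⟩)
  exact ⟨x, hx⟩

theorem mixCdf_eq_bounds {h x t : ℝ} (hh : 0 ≤ h) (ht : mixCdf h t = gaussCdf x) :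
    |t - x| ≤ h ∧ |t - x| ≤ h ^ 2 * |x| / 2 + h ^ 3 / 3 := by
  constructor
  · have h1 : x - h ≤ t := by
      rw [← (strictMono_mixCdf h).le_iff_le, ht]
      have := strictMono_gaussCdf.monotone (show x - h - h ≤ x by linarith)
      simp only [mixCdf, sub_add_cancel]
      linarith
    have h2 : t ≤ x + h := by
      rw [← (strictMono_mixCdf h).le_iff_le, ht]
      have := strictMono_gaussCdf.monotone (show x ≤ x + h + h by linarith)
      simp only [mixCdf, add_sub_cancel_right]
      linarith
    rw [abs_le]
    constructor <;> linarith
  · have key {x t : ℝ} (hx : 0 ≤ x) (ht : mixCdf h t = gaussCdf x) :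
        |t - x| ≤ h ^ 2 * |x| / 2 + h ^ 3 / 3 := by
      have h1 : x ≤ t := by
        rw [← (strictMono_mixCdf h).le_iff_le, ht]
        exact mixCdf_le_gaussCdf hh hx
      have h2 : t ≤ x + h ^ 2 * x / 2 + h ^ 3 / 3 := by
        rw [← (strictMono_mixCdf h).le_iff_le, ht]
        exact gaussCdf_le_mixCdf hh hx
      rw [abs_of_nonneg (by linarith), abs_of_nonneg hx]
      linarith
    rcases le_total 0 x with hx | hx
    · exact key hx ht
    · have := key (x := -x) (t := -t) (by linarith) (by rw [mixCdf_neg, gaussCdf_neg, ht])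
      rwa [abs_neg, ← neg_sub', abs_neg] at this

theorem cdf_gaussianReal_one (m x : ℝ) : cdf (gaussianReal m 1) x = gaussCdf (x - m) := by
  have hmap : (gaussianReal 0 1).map (· + m) = gaussianReal m 1 := by
    simpa using gaussianReal_map_add_const (μ := 0) (v := 1) m
  rw [gaussCdf, cdf_eq_real, cdf_eq_real, ← hmap,
    map_measureReal_apply (by fun_prop) measurableSet_Iic]
  congr 1
  ext
  simp [le_sub_iff_add_le]

theorem exists_transport_mixture {h : ℝ} (hh : 0 ≤ h) :
    ∃ T : ℝ → ℝ, Measurable T ∧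
      (gaussianReal 0 1).map T =
        (2 : ℝ≥0∞)⁻¹ • gaussianReal h 1 + (2 : ℝ≥0∞)⁻¹ • gaussianReal (-h) 1 ∧
      ∀ x, |T x - x| ≤ h ∧ |T x - x| ≤ h ^ 2 * |x| / 2 + h ^ 3 / 3 := by
  choose T hT using exists_mixCdf_eq hh
  have hmono : Monotone T := fun x y hxy => by
    rw [← (strictMono_mixCdf h).le_iff_le, hT, hT]
    exact strictMono_gaussCdf.monotone hxy
  refine ⟨T, hmono.measurable, ?_, fun x => mixCdf_eq_bounds hh (hT x)⟩
  have : IsProbabilityMeasure ((gaussianReal 0 1).map T) :=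
    Measure.isProbabilityMeasure_map hmono.measurable.aemeasurable
  refine Measure.ext_of_Iic _ _ fun t => ?_
  obtain ⟨x, hx⟩ := exists_gaussCdf_eq hh t
  have hset : T ⁻¹' Set.Iic t = Set.Iic x := by
    ext y
    rw [Set.mem_preimage, Set.mem_Iic, Set.mem_Iic, ← (strictMono_mixCdf h).le_iff_le, hT, ← hx,
      strictMono_gaussCdf.le_iff_le]
  have hhalf : (2 : ℝ≥0∞)⁻¹ = ENNReal.ofReal 2⁻¹ := by
    rw [ENNReal.ofReal_inv_of_pos zero_lt_two, ENNReal.ofReal_ofNat]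
  rw [Measure.map_apply hmono.measurable measurableSet_Iic, hset, Measure.add_apply,
    Measure.smul_apply, Measure.smul_apply, ← ofReal_cdf, ← ofReal_cdf, ← ofReal_cdf,
    cdf_gaussianReal_one, cdf_gaussianReal_one, cdf_gaussianReal_one, smul_eq_mul, smul_eq_mul,
    hhalf, ← ENNReal.ofReal_mul (by norm_num), ← ENNReal.ofReal_mul (by norm_num),
    ← ENNReal.ofReal_add, sub_zero, hx, mixCdf, sub_neg_eq_add]
  · congr 1
    ring
  all_goals exact mul_nonneg (by norm_num) (cdf_nonneg _ _)

theorem stdGaussian_eq (d : ℕ) :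
    _root_.stdGaussian d = ProbabilityTheory.stdGaussian (EuclideanSpace ℝ (Fin d)) :=
  map_pi_eq_stdGaussian

section Decomposition

variable {E : Type*} [NormedAddCommGroup E] [InnerProductSpace ℝ E]

/-- The projection of `z.1` on `eᗮ` plus `z.2 • e`. -/
def replaceComponent (e : E) (z : E × ℝ) : E := (z.1 - ⟪e, z.1⟫ • e) + z.2 • e

theorem replaceComponent_add (e : E) (w : E) (s c : ℝ) :
    replaceComponent e (w, s + c) = c • e + replaceComponent e (w, s) := by
  simp only [replaceComponent, add_smul]
  abel

variable [FiniteDimensional ℝ E] [MeasurableSpace E] [BorelSpace E]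

theorem measurable_replaceComponent (e : E) : Measurable (replaceComponent e) := by
  unfold replaceComponent
  fun_prop

theorem map_replaceComponent_stdGaussian {e : E} (he : ‖e‖ = 1) :
    ((ProbabilityTheory.stdGaussian E).prod (gaussianReal 0 1)).map (replaceComponent e) =
      ProbabilityTheory.stdGaussian E := by
  have hL : Measurable fun w : E => w - ⟪e, w⟫ • e := by fun_prop
  have hs : Measurable fun s : ℝ => s • e := by fun_prop
  have hcomp : replaceComponent e =
      (fun p : E × E => p.1 + p.2) ∘ Prod.map (fun w : E => w - ⟪e, w⟫ • e) fun s : ℝ => s • e :=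
    rfl
  have : IsProbabilityMeasure
      ((ProbabilityTheory.stdGaussian E).map fun w : E => w - ⟪e, w⟫ • e) :=
    Measure.isProbabilityMeasure_map hL.aemeasurable
  have : IsProbabilityMeasure ((gaussianReal 0 1).map fun s : ℝ => s • e) :=
    Measure.isProbabilityMeasure_map hs.aemeasurable
  have : IsProbabilityMeasure
      (((ProbabilityTheory.stdGaussian E).prod (gaussianReal 0 1)).map (replaceComponent e)) :=
    Measure.isProbabilityMeasure_map (measurable_replaceComponent e).aemeasurable
  refine Measure.ext_of_charFun (funext fun t => ?_)
  rw [hcomp, ← Measure.map_map (by fun_prop) (hL.prodMap hs),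
    ← Measure.map_prod_map _ _ hL hs, charFun_map_add_prod_eq_mul]
  have h1 : charFun ((ProbabilityTheory.stdGaussian E).map fun w : E => w - ⟪e, w⟫ • e) t =
      charFun (ProbabilityTheory.stdGaussian E) (t - ⟪e, t⟫ • e) := by
    rw [charFun_apply, charFun_apply, integral_map hL.aemeasurable (by fun_prop)]
    congr 1
    ext w
    congr 3
    simp only [inner_sub_left, inner_sub_right, real_inner_smul_left, real_inner_smul_right,
      real_inner_comm w e]
    ring
  have h2 : charFun ((gaussianReal 0 1).map fun s : ℝ => s • e) t =
      charFun (gaussianReal 0 1) ⟪e, t⟫ := by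
    rw [charFun_apply, charFun_apply_real, integral_map hs.aemeasurable (by fun_prop)]
    congr 1
    ext s
    congr 1
    rw [real_inner_smul_left]
    push_cast
    ring
  rw [Pi.mul_apply, h1, h2, charFun_stdGaussian, charFun_stdGaussian, charFun_gaussianReal, ← Complex.exp_add]
  have h3 : ‖t - ⟪e, t⟫ • e‖ ^ 2 = ‖t‖ ^ 2 - ⟪e, t⟫ ^ 2 := by
    rw [norm_sub_sq_real, real_inner_smul_right, norm_smul, he, real_inner_comm, Real.norm_eq_abs,
      mul_one, sq_abs]
    ring
  congr 1
  rw [← Complex.ofReal_pow, h3]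
  push_cast
  ring

theorem map_replaceComponent_gaussianReal {e : E} (he : ‖e‖ = 1) (c : ℝ) :
    ((ProbabilityTheory.stdGaussian E).prod (gaussianReal c 1)).map (replaceComponent e) =
      (ProbabilityTheory.stdGaussian E).map (c • e + ·) := by
  have hmap : (gaussianReal 0 1).map (· + c) = gaussianReal c 1 := by
    simpa using gaussianReal_map_add_const (μ := 0) (v := 1) c
  have hadd : Measurable fun s : ℝ => s + c := by fun_prop
  rw [← hmap]
  nth_rw 1 [← Measure.map_id (μ := ProbabilityTheory.stdGaussian E)]
  nth_rw 2 [← map_replaceComponent_stdGaussian he]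
  rw [Measure.map_prod_map _ _ measurable_id hadd,
    Measure.map_map (measurable_replaceComponent e) (measurable_id.prodMap hadd),
    Measure.map_map (by fun_prop) (measurable_replaceComponent e)]
  congr 1
  ext z
  exact replaceComponent_add e z.1 z.2 c

end Decomposition

theorem Wp_le_of_mem_couplings {E : Type*} [MeasurableSpace E] [NormedAddCommGroup E] {p : ℝ}
    (hp : 1 ≤ p) {μ ν : Measure E} {τ : Measure (E × E)} (hτ : τ ∈ couplings μ ν) :
    Wp p μ ν ≤ (∫⁻ z, ENNReal.ofReal (‖z.1 - z.2‖ ^ p) ∂τ) ^ (1 / p) :=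
  ENNReal.rpow_le_rpow (iInf₂_le τ hτ) (by positivity)

theorem Wp_mixture_le_transport {d : ℕ} {e : EuclideanSpace ℝ (Fin d)} (he : ‖e‖ = 1)
    (m : EuclideanSpace ℝ (Fin d)) {p h : ℝ} (hp : 1 ≤ p) {T : ℝ → ℝ} (hT : Measurable T)
    (hmap : (gaussianReal 0 1).map T =
      (2 : ℝ≥0∞)⁻¹ • gaussianReal h 1 + (2 : ℝ≥0∞)⁻¹ • gaussianReal (-h) 1) :
    Wp p ((2 : ℝ≥0∞)⁻¹ • gaussianE d (m + h • e) + (2 : ℝ≥0∞)⁻¹ • gaussianE d (m - h • e))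
        (gaussianE d m) ≤
      (∫⁻ s, ENNReal.ofReal (|T s - s| ^ p) ∂(gaussianReal 0 1)) ^ (1 / p) := by
  have hR := measurable_replaceComponent e
  have hTs : Measurable (Prod.map (id : EuclideanSpace ℝ (Fin d) → _) T) :=
    measurable_id.prodMap hT
  have hf : Measurable fun z : EuclideanSpace ℝ (Fin d) × ℝ =>
      m + replaceComponent e (z.1, T z.2) :=
    (hR.comp hTs).const_add m
  have hg : Measurable fun z : EuclideanSpace ℝ (Fin d) × ℝ => m + replaceComponent e z := hR.const_add m
  have hshift (c : ℝ) :
      (((ProbabilityTheory.stdGaussian (EuclideanSpace ℝ (Fin d))).prod (gaussianReal c 1)).map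
        (replaceComponent e)).map (m + ·) = gaussianE d (m + c • e) := by
    rw [map_replaceComponent_gaussianReal he, gaussianE, stdGaussian_eq,
      Measure.map_map (by fun_prop) (by fun_prop)]
    congr 1
    ext1 x
    exact (add_assoc _ _ _).symm
  have hτ : ((ProbabilityTheory.stdGaussian (EuclideanSpace ℝ (Fin d))).prod
      (gaussianReal 0 1)).map
        (fun z => (m + replaceComponent e (z.1, T z.2), m + replaceComponent e z)) ∈
      couplings
        ((2 : ℝ≥0∞)⁻¹ • gaussianE d (m + h • e) + (2 : ℝ≥0∞)⁻¹ • gaussianE d (m - h • e))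
        (gaussianE d m) := by
    constructor
    · rw [Measure.map_map measurable_fst (hf.prodMk hg)]
      have hcomp : Prod.fst ∘ (fun z => (m + replaceComponent e (z.1, T z.2),
          m + replaceComponent e z)) = (m + ·) ∘ replaceComponent e ∘ Prod.map id T := rfl
      rw [hcomp, ← Measure.map_map (by fun_prop) (hR.comp hTs),
        ← Measure.map_map hR hTs, ← Measure.map_prod_map _ _ measurable_id hT, Measure.map_id,
        hmap, Measure.prod_add, Measure.prod_smul_right, Measure.prod_smul_right,
        Measure.map_add _ _ hR, Measure.map_add _ _ (by fun_prop)]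
      simp only [Measure.map_smul, hshift]
      rw [neg_smul, ← sub_eq_add_neg]
    · rw [Measure.map_map measurable_snd (hf.prodMk hg)]
      have := hshift 0
      rw [zero_smul, add_zero, Measure.map_map (by fun_prop) hR] at this
      exact this
  refine (Wp_le_of_mem_couplings hp hτ).trans (ENNReal.rpow_le_rpow ?_ (by positivity))
  rw [lintegral_map (by fun_prop) (hf.prodMk hg)]
  have hnorm (z : EuclideanSpace ℝ (Fin d) × ℝ) :
      ‖(m + replaceComponent e (z.1, T z.2)) - (m + replaceComponent e z)‖ = |T z.2 - z.2| := by
    rw [add_sub_add_left_eq_sub, replaceComponent, replaceComponent, add_sub_add_left_eq_sub,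
      ← sub_smul, norm_smul, he, mul_one, Real.norm_eq_abs]
  simp only [hnorm]
  rw [lintegral_prod _ (by fun_prop)]
  simp

theorem lintegral_abs_rpow_gaussianReal {p : ℝ} (hp : 1 ≤ p) :
    (∫⁻ s, ENNReal.ofReal |s| ^ p ∂(gaussianReal 0 1)) ^ (1 / p) =
      ENNReal.ofReal (Cconst p) := by
  have hp0 : 0 < p := by linarith
  have hint : Integrable (fun s : ℝ => |s| ^ p) (gaussianReal 0 1) := by
    have := (memLp_id_gaussianReal' (μ := 0) (v := 1) (ENNReal.ofReal p)
      ENNReal.ofReal_ne_top).integrable_norm_rpow (by simpa using hp0) ENNReal.ofReal_ne_top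
    simpa [ENNReal.toReal_ofReal hp0.le] using this
  rw [Cconst, ← ENNReal.ofReal_rpow_of_nonneg (by positivity) (by positivity),
    ofReal_integral_eq_lintegral_ofReal hint (ae_of_all _ fun s => by positivity)]
  simp_rw [ENNReal.ofReal_rpow_of_nonneg (abs_nonneg _) hp0.le]

theorem lintegral_transport_le {p h : ℝ} (hp : 1 ≤ p) (hh : 0 ≤ h) {T : ℝ → ℝ}
    (hT : ∀ x, |T x - x| ≤ h ∧ |T x - x| ≤ h ^ 2 * |x| / 2 + h ^ 3 / 3) :
    (∫⁻ s, ENNReal.ofReal (|T s - s| ^ p) ∂(gaussianReal 0 1)) ^ (1 / p) ≤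
      ENNReal.ofReal (Kconst p * h ^ 2) := by
  have hp0 : 0 < p := by linarith
  have hC : 0 ≤ Cconst p := by unfold Cconst; positivity
  simp_rw [← ENNReal.ofReal_rpow_of_nonneg (abs_nonneg _) hp0.le]
  rcases le_total 1 h with h1 | h1
  · calc (∫⁻ s, ENNReal.ofReal |T s - s| ^ p ∂(gaussianReal 0 1)) ^ (1 / p)
        ≤ (∫⁻ _, ENNReal.ofReal h ^ p ∂(gaussianReal 0 1)) ^ (1 / p) := by
          gcongr with s
          exact (hT s).1
      _ = ENNReal.ofReal h := by
          rw [lintegral_const, measure_univ, mul_one, ← ENNReal.rpow_mul,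
            mul_one_div_cancel hp0.ne', ENNReal.rpow_one]
      _ ≤ ENNReal.ofReal (Kconst p * h ^ 2) := by
          gcongr
          have : 1 ≤ Kconst p := le_max_left _ _
          nlinarith [mul_le_mul_of_nonneg_right this (sq_nonneg h)]
  · calc (∫⁻ s, ENNReal.ofReal |T s - s| ^ p ∂(gaussianReal 0 1)) ^ (1 / p)
        ≤ (∫⁻ s, ((fun s : ℝ => ENNReal.ofReal (h ^ 2 / 2) * ENNReal.ofReal |s|) +
            fun _ : ℝ => ENNReal.ofReal (h ^ 2 / 3)) s ^ p ∂(gaussianReal 0 1)) ^ (1 / p) := by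
          gcongr with s
          rw [Pi.add_apply, ← ENNReal.ofReal_mul (by positivity),
            ← ENNReal.ofReal_add (by positivity) (by positivity)]
          gcongr
          have := (hT s).2
          nlinarith [mul_nonneg (sq_nonneg h) (sub_nonneg.2 h1)]
      _ ≤ (∫⁻ s, (ENNReal.ofReal (h ^ 2 / 2) * ENNReal.ofReal |s|) ^ p
              ∂(gaussianReal 0 1)) ^ (1 / p) +
            (∫⁻ _, ENNReal.ofReal (h ^ 2 / 3) ^ p ∂(gaussianReal 0 1)) ^ (1 / p) :=
          ENNReal.lintegral_Lp_add_le (by fun_prop) (by fun_prop) hp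
      _ = ENNReal.ofReal (h ^ 2 / 2) * ENNReal.ofReal (Cconst p) + ENNReal.ofReal (h ^ 2 / 3) := by
          simp_rw [ENNReal.mul_rpow_of_nonneg _ _ hp0.le]
          rw [lintegral_const_mul _ (by fun_prop), lintegral_const, measure_univ, mul_one,
            ENNReal.mul_rpow_of_nonneg _ _ (by positivity), ← ENNReal.rpow_mul, ← ENNReal.rpow_mul,
            mul_one_div_cancel hp0.ne', ENNReal.rpow_one, ENNReal.rpow_one,
            lintegral_abs_rpow_gaussianReal hp]
      _ ≤ ENNReal.ofReal (Kconst p * h ^ 2) := by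
          rw [← ENNReal.ofReal_mul (by positivity),
            ← ENNReal.ofReal_add (by positivity) (by positivity)]
          gcongr
          have : Cconst p / 2 + 1 / 3 ≤ Kconst p := le_max_right _ _
          nlinarith [mul_le_mul_of_nonneg_right this (sq_nonneg h)]

theorem Wp_self {E : Type*} [MeasurableSpace E] [NormedAddCommGroup E]
    [BorelSpace E] [SecondCountableTopology E] {p : ℝ} (hp : 1 ≤ p) (μ : Measure E) :
    Wp p μ μ = 0 := by
  have hp0 : 0 < p := by linarith
  have hd : Measurable fun x : E => (x, x) := by fun_prop
  have hτ : μ.map (fun x => (x, x)) ∈ couplings μ μ := by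
    constructor
    · rw [Measure.map_map measurable_fst hd]
      exact Measure.map_id
    · rw [Measure.map_map measurable_snd hd]
      exact Measure.map_id
  refine le_antisymm ((Wp_le_of_mem_couplings hp hτ).trans ?_) zero_le
  rw [lintegral_map (by fun_prop) hd]
  simp [Real.zero_rpow hp0.ne', hp0]

/-- one-step `W_p` coupling for a two-component Gaussian mixture and the
Gaussian at the midpoint. -/
theorem wasserstein_two_gaussian_midpoint
    (d : ℕ) (a b : EuclideanSpace ℝ (Fin d)) (p : ℝ) (hp : 1 ≤ p) :
    Wp p ((2 : ℝ≥0∞)⁻¹ • gaussianE d a + (2 : ℝ≥0∞)⁻¹ • gaussianE d b)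
        (gaussianE d ((2 : ℝ)⁻¹ • (a + b))) ≤
      ENNReal.ofReal (Kconst p / 4 * ‖a - b‖ ^ 2) := by
  rcases eq_or_ne a b with rfl | hab
  · have hmid : (2 : ℝ)⁻¹ • (a + a) = a := by
      rw [← two_smul ℝ a, inv_smul_smul₀ two_ne_zero]
    rw [hmid, ← add_smul, ENNReal.inv_two_add_inv_two, one_smul, Wp_self hp]
    exact zero_le
  have hn : ‖a - b‖ ≠ 0 := norm_ne_zero_iff.2 (sub_ne_zero.2 hab)
  have he : ‖‖a - b‖⁻¹ • (a - b)‖ = 1 := by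
    rw [norm_smul, norm_inv, norm_norm, inv_mul_cancel₀ hn]
  have hhe : (‖a - b‖ / 2) • ‖a - b‖⁻¹ • (a - b) = (2 : ℝ)⁻¹ • (a - b) := by
    rw [smul_smul]
    congr 1
    field_simp
  have hh : 0 ≤ ‖a - b‖ / 2 := by positivity
  obtain ⟨T, hT, hmap, hbd⟩ := exists_transport_mixture hh
  have h := (Wp_mixture_le_transport he ((2 : ℝ)⁻¹ • (a + b)) hp hT hmap).trans
    (lintegral_transport_le hp hh hbd)
  have ha : (2 : ℝ)⁻¹ • (a + b) + (2 : ℝ)⁻¹ • (a - b) = a := by module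
  have hb : (2 : ℝ)⁻¹ • (a + b) - (2 : ℝ)⁻¹ • (a - b) = b := by module
  rw [hhe, ha, hb] at h
  refine h.trans_eq (congrArg ENNReal.ofReal ?_)
  ring

end
end
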